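/- Let A be a finite set of positive integers with max A = d and gcd(A) = p, and let k be a positive integer divisible by p. Then, as n → ∞ along multiples of p, (|S_{n-k}^{(A)}|/(n-k)!) / (|S_n^{(A)}|/n!) ~ n^{k/d}. -/

import Mathlib

open Filter

noncomputable def permCount (A : Set ℕ) (n : ℕ) : ℕ :=
  Nat.card {σ : Equiv.Perm (Fin n) // ∀ x, Function.minimalPeriod ⇑σ x ∈ A}

lemma minPer_of_moved {α : Type*} [Fintype α] [DecidableEq α] (σ : Equiv.Perm α) (x : α)
    (hx : σ x ≠ x) : Function.minimalPeriod σ x = (σ.cycleOf x).support.card := by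
  have h := σ.isCycleOn_support_cycleOf x
  have hm : x ∈ (σ.cycleOf x).support := by
    rw [Equiv.Perm.mem_support_cycleOf_iff]
    exact ⟨Equiv.Perm.SameCycle.refl _ _, by simpa using hx⟩
  apply Nat.dvd_antisymm
  · apply Function.IsPeriodicPt.minimalPeriod_dvd
    have := (h.pow_apply_eq hm (n := (σ.cycleOf x).support.card)).2 dvd_rfl
    rw [Function.IsPeriodicPt, Function.IsFixedPt, Equiv.Perm.iterate_eq_pow]
    exact this
  · rw [← h.pow_apply_eq hm, ← Equiv.Perm.iterate_eq_pow]
    exact Function.iterate_minimalPeriod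

lemma minPer_iff {α : Type*} [Fintype α] [DecidableEq α] (A : Set ℕ) (σ : Equiv.Perm α) :
    (∀ x, Function.minimalPeriod σ x ∈ A) ↔ ∀ i ∈ σ.partition.parts, i ∈ A := by
  rw [Equiv.Perm.parts_partition]
  constructor
  · intro h i hi
    rcases Multiset.mem_add.1 hi with hi | hi
    · rw [Equiv.Perm.cycleType_def, Multiset.mem_map] at hi
      obtain ⟨c, hc, rfl⟩ := hi
      have hc' : c ∈ σ.cycleFactorsFinset := hc
      have hcy := (Equiv.Perm.mem_cycleFactorsFinset_iff.1 hc').1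
      obtain ⟨x, hx⟩ := hcy.nonempty_support
      have := (Equiv.Perm.eq_cycleOf_of_mem_cycleFactorsFinset_iff σ c hc' x).2 hx
      have hxs : x ∈ σ.support := Equiv.Perm.mem_cycleFactorsFinset_support_le hc' hx
      have h2 := h x
      rw [minPer_of_moved σ x (by simpa using hxs), ← this] at h2
      exact h2
    · obtain ⟨h1, rfl⟩ := Multiset.mem_replicate.1 hi
      have : ∃ x, x ∉ σ.support := by
        by_contra! hcon
        apply h1
        have : σ.support = Finset.univ := by ext x; simp [hcon x]
        simp [this]
      obtain ⟨x, hx⟩ := this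
      have h2 := h x
      rwa [Function.minimalPeriod_eq_one_iff_isFixedPt.2 (by simpa [Function.IsFixedPt] using hx)] at h2
  · intro h x
    by_cases hx : σ x = x
    · rw [Function.minimalPeriod_eq_one_iff_isFixedPt.2 hx]
      apply h
      apply Multiset.mem_add.2 (Or.inr _)
      rw [Multiset.mem_replicate]
      refine ⟨?_, rfl⟩
      have : σ.support.card < Fintype.card α := by
        rw [Finset.card_lt_iff_ne_univ]
        intro h3
        have : x ∈ σ.support := h3 ▸ Finset.mem_univ x
        simp [hx] at this
      omega
    · rw [minPer_of_moved σ x hx]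
      apply h
      apply Multiset.mem_add.2 (Or.inl _)
      rw [Equiv.Perm.cycleType_def, Multiset.mem_map]
      exact ⟨σ.cycleOf x, (Equiv.Perm.cycleOf_mem_cycleFactorsFinset_iff.2 (by simpa using hx)), rfl⟩

noncomputable def wgt (m : Multiset ℕ) : ℝ :=
  ((m.prod : ℝ) * ∏ i ∈ m.toFinset, ((m.count i).factorial : ℝ))⁻¹

lemma prod_count_superset (m : Multiset ℕ) (s : Finset ℕ) (h : m.toFinset ⊆ s) :
    ∏ i ∈ m.toFinset, ((m.count i).factorial : ℝ) = ∏ i ∈ s, ((m.count i).factorial : ℝ) := by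
  apply Finset.prod_subset h
  intro x _ hx
  rw [Multiset.mem_toFinset] at hx
  simp [Multiset.count_eq_zero_of_notMem hx]

lemma count_parts {α : Type*} [Fintype α] [DecidableEq α] (π : (Fintype.card α).Partition) :
    ((Finset.univ.filter (fun σ : Equiv.Perm α => σ.partition = π)).card : ℝ)
      = (Fintype.card α).factorial * wgt π.parts := by
  set f := π.parts.filter (fun n => 2 ≤ n) with hf
  have h1 : π.parts = f + Multiset.replicate (Fintype.card α - f.sum) 1 := by
    have e := Multiset.filter_add_not (fun n => 2 ≤ n) π.parts
    have e2 : π.parts.filter (fun n => ¬ 2 ≤ n) =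
        Multiset.replicate (π.parts.filter (fun n => ¬ 2 ≤ n)).card 1 := by
      rw [Multiset.eq_replicate]
      refine ⟨rfl, fun b hb => ?_⟩
      rw [Multiset.mem_filter] at hb
      have := π.parts_pos hb.1
      omega
    have e3 := π.parts_sum
    rw [← e, Multiset.sum_add, e2, Multiset.sum_replicate] at e3
    simp only [smul_eq_mul, mul_one] at e3
    rw [← hf] at e3 e
    conv_lhs => rw [← e, e2]
    congr 2
    omega
  have h2 : ∀ σ : Equiv.Perm α, σ.partition = π ↔ σ.cycleType = f := by
    intro σ
    constructor
    · rintro rfl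
      rw [hf, Equiv.Perm.filter_parts_partition_eq_cycleType]
    · intro h
      rw [Nat.Partition.ext_iff, h1, Equiv.Perm.parts_partition, ← Equiv.Perm.sum_cycleType, h]
  simp_rw [h2]
  have hle : f.sum ≤ Fintype.card α := by
    have := π.parts_sum
    rw [h1, Multiset.sum_add] at this
    omega
  have h3 := Equiv.Perm.card_of_cycleType_mul_eq α f
  rw [if_pos ⟨hle, fun a ha => (Multiset.mem_filter.1 ha).2⟩] at h3
  have h1f : 1 ∉ f := fun ha => by have := (Multiset.mem_filter.1 ha).2; omega
  have hw : wgt π.parts = ((((Fintype.card α - f.sum).factorial * f.prod *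
      (∏ n ∈ f.toFinset, (f.count n).factorial) : ℕ)) : ℝ)⁻¹ := by
    rw [wgt, prod_count_superset _ (insert 1 f.toFinset), Finset.prod_insert (by simpa using h1f)]
    · rw [h1]
      have : ∏ x ∈ f.toFinset, (((Multiset.count x
          (f + Multiset.replicate (Fintype.card α - f.sum) 1)).factorial : ℕ) : ℝ)
          = ∏ x ∈ f.toFinset, (((Multiset.count x f).factorial : ℕ) : ℝ) := by
        apply Finset.prod_congr rfl
        intro x hx
        have : x ≠ 1 := by rintro rfl; exact h1f (by simpa using hx)
        rw [Multiset.count_add, Multiset.count_replicate, if_neg this.symm]; simp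
      rw [this]
      simp [Multiset.count_eq_zero_of_notMem h1f]
      ring
    · rw [h1]
      intro x
      simp only [Multiset.toFinset_add, Finset.mem_union, Multiset.mem_toFinset, Multiset.mem_replicate, Finset.mem_insert]
      tauto
  rw [hw, eq_mul_inv_iff_mul_eq₀]
  · exact_mod_cast h3
  · have : f.prod ≠ 0 := by
      intro h0
      rw [Multiset.prod_eq_zero_iff] at h0
      have := (Multiset.mem_filter.1 h0).2; omega
    have : ∏ n ∈ f.toFinset, (f.count n).factorial ≠ 0 :=
      Finset.prod_ne_zero_iff.2 fun _ _ => Nat.factorial_ne_zero _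
    have := Nat.factorial_ne_zero (Fintype.card α - f.sum)
    norm_cast
    positivity

open Classical in
noncomputable def Sw (A : Set ℕ) (n : ℕ) : ℝ :=
  ∑ π ∈ Nat.Partition.restricted n (fun i => i ∈ A), wgt π.parts

lemma card_perm_eq {α : Type*} [Fintype α] [DecidableEq α] (A : Set ℕ) :
    (Nat.card {σ : Equiv.Perm α // ∀ x, Function.minimalPeriod ⇑σ x ∈ A} : ℝ)
      = (Fintype.card α).factorial * Sw A (Fintype.card α) := by
  classical
  rw [Nat.card_eq_fintype_card, Fintype.card_subtype]
  simp_rw [minPer_iff]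
  rw [Finset.card_eq_sum_card_fiberwise (f := Equiv.Perm.partition)
    (t := Nat.Partition.restricted (Fintype.card α) (fun i => i ∈ A))]
  · rw [Sw, Finset.mul_sum]
    push_cast
    apply Finset.sum_congr
    · congr
    · intro π hπ
      rw [← count_parts]
      congr 2
      ext σ
      simp only [Finset.mem_filter, Finset.mem_univ, true_and, and_iff_right_iff_imp]
      rintro rfl
      simpa [Nat.Partition.restricted] using hπ
  · intro σ hσ
    simpa [Nat.Partition.restricted] using hσ

lemma permCount_div (A : Set ℕ) (n : ℕ) : (permCount A n : ℝ) / n.factorial = Sw A n := by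
  have := card_perm_eq (α := Fin n) A
  rw [Fintype.card_fin] at this
  rw [permCount, this]
  have := Nat.factorial_ne_zero n
  field_simp

lemma wgt_erase (m : Multiset ℕ) (a : ℕ) (ha : a ∈ m) (ha0 : 0 < a) :
    ((m.count a * a : ℕ) : ℝ) * wgt m = wgt (m.erase a) := by
  obtain ⟨t, rfl⟩ := Multiset.exists_cons_of_mem ha
  rw [Multiset.erase_cons_head, wgt, wgt,
    prod_count_superset t (insert a t.toFinset) (Finset.subset_insert _ _), Multiset.toFinset_cons]
  rw [← Finset.mul_prod_erase _ _ (Finset.mem_insert_self a _),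
    ← Finset.mul_prod_erase _ _ (Finset.mem_insert_self a _)]
  have : ∏ x ∈ (insert a t.toFinset).erase a, ((Multiset.count x (a ::ₘ t)).factorial : ℝ)
     = ∏ x ∈ (insert a t.toFinset).erase a, ((Multiset.count x t).factorial : ℝ) := by
    apply Finset.prod_congr rfl
    intro x hx
    rw [Multiset.count_cons_of_ne (Finset.ne_of_mem_erase hx)]
  rw [this, Multiset.count_cons_self, Multiset.prod_cons, Nat.factorial_succ]
  push_cast
  have : (t.count a : ℝ) + 1 ≠ 0 := by positivity
  have : (a : ℝ) ≠ 0 := by positivity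
  simp only [mul_inv]
  field_simp

lemma Sw_rec (A : Finset ℕ) (hA : ∀ a ∈ A, 0 < a) (n : ℕ) :
    (n : ℝ) * Sw A n = ∑ a ∈ A with a ≤ n, Sw A (n - a) := by
  classical
  have h1 : ∀ π ∈ Nat.Partition.restricted n (fun i => i ∈ (A : Set ℕ)),
      (n : ℝ) * wgt π.parts = ∑ a ∈ A with a ≤ n, if a ∈ π.parts then wgt (π.parts.erase a) else 0 := by
    intro π hπ
    have hπ' : ∀ i ∈ π.parts, i ∈ A := by simpa [Nat.Partition.restricted] using hπ
    rw [← Finset.sum_filter]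
    have : (A.filter (fun a => a ≤ n)).filter (fun a => a ∈ π.parts) = π.parts.toFinset := by
      ext x
      simp only [Finset.mem_filter, Multiset.mem_toFinset]
      exact ⟨fun h => h.2, fun h => ⟨⟨hπ' x h, Nat.Partition.le_of_mem_parts h⟩, h⟩⟩
    rw [this]
    have e := π.parts_sum
    rw [Finset.sum_multiset_count] at e
    have e' : (n : ℝ) = ∑ m ∈ π.parts.toFinset, ((π.parts.count m * m : ℕ) : ℝ) := by
      conv_lhs => rw [← e]
      push_cast
      simp
    rw [e', Finset.sum_mul]
    apply Finset.sum_congr rfl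
    intro x hx
    rw [Multiset.mem_toFinset] at hx
    rw [← wgt_erase _ _ hx (π.parts_pos hx)]
  rw [Sw, Finset.mul_sum]
  have e : ∑ i ∈ Nat.Partition.restricted n (fun i => i ∈ (A : Set ℕ)), (n : ℝ) * wgt i.parts =
    ∑ i ∈ Nat.Partition.restricted n (fun i => i ∈ (A : Set ℕ)), ∑ a ∈ A with a ≤ n, if a ∈ i.parts then wgt (i.parts.erase a) else 0 :=
    Finset.sum_congr rfl h1
  convert! e using 1
  · congr!
  rw [Finset.sum_comm]
  apply Finset.sum_congr rfl
  intro a ha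
  rw [Finset.mem_filter] at ha
  rw [← Finset.sum_filter, Sw]
  symm
  refine Finset.sum_bij (fun π hπ => ((Nat.Partition.partitionWithPartEquiv (hA a ha.1) ha.2) ⟨π, (Finset.mem_filter.1 hπ).2⟩)) ?_ ?_ ?_ ?_
  · intro π hπ
    have := (Finset.mem_filter.1 hπ).1
    simp only [Nat.Partition.restricted, Finset.mem_filter, Finset.mem_univ, true_and, Nat.Partition.partitionWithPartEquiv_apply_parts] at this ⊢
    intro i hi
    exact this i (Multiset.mem_of_mem_erase hi)
  · intro π hπ π' hπ' h
    have := (Nat.Partition.partitionWithPartEquiv (hA a ha.1) ha.2).injective h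
    simpa using this
  · intro π hπ
    refine ⟨((Nat.Partition.partitionWithPartEquiv (hA a ha.1) ha.2).symm π).1, ?_, by simp⟩
    rw [Finset.mem_filter]
    refine ⟨?_, ((Nat.Partition.partitionWithPartEquiv (hA a ha.1) ha.2).symm π).2⟩
    simp only [Nat.Partition.restricted, Finset.mem_filter, Finset.mem_univ, true_and, Nat.Partition.partitionWithPartEquiv_symm_apply_parts] at hπ ⊢
    intro i hi
    rcases Multiset.mem_cons.1 hi with rfl | hi
    · exact ha.1
    · exact hπ i hi
  · intro π hπ
    simp [Nat.Partition.partitionWithPartEquiv_apply_parts]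

lemma Sw_zero (A : Set ℕ) : Sw A 0 = 1 := by
  classical
  rw [← permCount_div]
  have : permCount A 0 = 1 := by
    rw [permCount, Nat.card_eq_one_iff_unique]
    exact ⟨inferInstance, ⟨⟨1, fun x => x.elim0⟩⟩⟩
  simp [this]

noncomputable def EE (B : Finset ℕ) (c r : ℝ) (n : ℤ) (θ : ℝ) : ℂ :=
  Complex.exp (∑ a ∈ B, ((r ^ a / (c * a) : ℝ) : ℂ) * (Complex.exp (a * θ * Complex.I) - 1)
    - n * θ * Complex.I)

lemma EE_cont (B : Finset ℕ) (c r : ℝ) (n : ℤ) : Continuous (EE B c r n) := by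
  unfold EE; fun_prop

lemma EE_periodic (B : Finset ℕ) (c r : ℝ) (n : ℤ) :
    Function.Periodic (EE B c r n) (2 * Real.pi) := by
  intro θ
  unfold EE
  have h : ∀ a : ℕ, Complex.exp (a * ((θ + 2 * Real.pi : ℝ) : ℂ) * Complex.I)
      = Complex.exp (a * θ * Complex.I) := by
    intro a
    rw [Complex.exp_eq_exp_iff_exists_int]
    exact ⟨a, by push_cast; ring⟩
  simp_rw [h]
  rw [Complex.exp_eq_exp_iff_exists_int]
  exact ⟨-n, by push_cast; ring⟩

lemma EE_deriv (B : Finset ℕ) (hB : ∀ a ∈ B, 0 < a) (c r : ℝ) (hc : 0 < c) (n : ℤ) (θ : ℝ) :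
    HasDerivAt (EE B c r n)
      (Complex.I * (∑ a ∈ B, ((r ^ a / c : ℝ) : ℂ) * EE B c r (n - a) θ - n * EE B c r n θ)) θ := by
  have h1 : ∀ a ∈ B, HasDerivAt (fun θ : ℝ => ((r ^ a / (c * a) : ℝ) : ℂ) *
      (Complex.exp (a * θ * Complex.I) - 1))
      (((r ^ a / c : ℝ) : ℂ) * Complex.exp (a * θ * Complex.I) * Complex.I) θ := by
    intro a ha
    have h0 : HasDerivAt (fun θ : ℝ => (a : ℂ) * θ * Complex.I) (a * 1 * Complex.I) θ :=
      ((Complex.ofRealCLM.hasDerivAt (x := θ)).const_mul (a : ℂ)).mul_const Complex.I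
    have h2 := ((h0.cexp.sub_const 1).const_mul ((r ^ a / (c * a) : ℝ) : ℂ))
    refine h2.congr_deriv ?_
    have : (a : ℂ) ≠ 0 := by exact_mod_cast (hB a ha).ne'
    have : (c : ℂ) ≠ 0 := by exact_mod_cast hc.ne'
    push_cast
    field_simp
  have h2 := HasDerivAt.fun_sum h1
  have h3 : HasDerivAt (fun θ : ℝ => (n : ℂ) * θ * Complex.I) (n * 1 * Complex.I) θ :=
      ((Complex.ofRealCLM.hasDerivAt (x := θ)).const_mul (n : ℂ)).mul_const Complex.I
  have h4 := (h2.sub h3).cexp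
  have h5 : ∀ a : ℕ, EE B c r (n - a) θ = EE B c r n θ * Complex.exp (a * θ * Complex.I) := by
    intro a
    unfold EE
    rw [← Complex.exp_add]
    congr 1
    push_cast
    ring
  simp_rw [h5]
  convert! h4 using 1
  change _ = EE B c r n θ * _
  rw [mul_sub, mul_sub, Finset.mul_sum, Finset.mul_sum]
  congr 1
  · apply Finset.sum_congr rfl
    intros; ring
  · ring

noncomputable def JJ (B : Finset ℕ) (c r : ℝ) (n : ℤ) : ℂ :=
  ∫ θ in (-Real.pi)..Real.pi, EE B c r n θ

lemma JJ_rec (B : Finset ℕ) (hB : ∀ a ∈ B, 0 < a) (c r : ℝ) (hc : 0 < c) (n : ℤ) :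
    (n : ℂ) * JJ B c r n = ∑ a ∈ B, ((r ^ a / c : ℝ) : ℂ) * JJ B c r (n - a) := by
  have hi : ∀ n, IntervalIntegrable (EE B c r n) MeasureTheory.volume (-Real.pi) Real.pi :=
    fun n => (EE_cont B c r n).intervalIntegrable _ _
  have hs : IntervalIntegrable (fun θ => ∑ a ∈ B, ((r ^ a / c : ℝ) : ℂ) * EE B c r (n - a) θ)
      MeasureTheory.volume (-Real.pi) Real.pi := by
    apply Continuous.intervalIntegrable
    have := EE_cont B c r
    fun_prop
  have h := intervalIntegral.integral_eq_sub_of_hasDerivAt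
    (f := EE B c r n) (a := -Real.pi) (b := Real.pi) (fun θ _ => EE_deriv B hB c r hc n θ)
    ((hs.sub ((hi n).const_mul _)).const_mul _)
  have hper : EE B c r n Real.pi = EE B c r n (-Real.pi) := by
    have := EE_periodic B c r n (-Real.pi)
    rw [← this]; congr 1; ring
  rw [hper, sub_self, intervalIntegral.integral_const_mul, intervalIntegral.integral_sub hs ((hi n).const_mul _),
    intervalIntegral.integral_finsetSum (fun (a : ℕ) _ => (hi (n - a)).const_mul _)] at h
  simp_rw [intervalIntegral.integral_const_mul] at h
  have := (mul_eq_zero.1 h).resolve_left Complex.I_ne_zero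
  exact (sub_eq_zero.1 this).symm

noncomputable def KK (B : Finset ℕ) (c r : ℝ) : ℝ := ∑ a ∈ B, r ^ a / (c * a)

lemma JJ_neg (B : Finset ℕ) (hB : ∀ a ∈ B, 0 < a) (c r : ℝ) (hr : 0 < r) (j : ℕ) :
    JJ B c r (-j) = if j = 0 then ((2 * Real.pi * Real.exp (-KK B c r) : ℝ) : ℂ) else 0 := by
  set g : ℂ → ℂ := fun z => Complex.exp (∑ a ∈ B, ((1 / (c * a) : ℝ) : ℂ) * (z ^ a - (r : ℂ) ^ a)) * z ^ j with hg
  have hd : Differentiable ℂ g := by rw [hg]; fun_prop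
  have h := (hd.diffContOnCl (s := Metric.ball 0 |r|)).circleAverage
  rw [Real.circleAverage_def] at h
  have h2 : ∀ θ, g (circleMap 0 r θ) = (r : ℂ) ^ j * EE B c r (-j) θ := by
    intro θ
    simp only [hg, EE, circleMap, zero_add]
    rw [mul_pow, ← Complex.exp_nat_mul, mul_left_comm, ← Complex.exp_add]
    congr 2
    rw [sub_eq_add_neg]
    congr 1
    · apply Finset.sum_congr rfl
      intro a ha
      rw [mul_pow, ← Complex.exp_nat_mul]
      push_cast
      ring_nf
    · push_cast; ring
  simp_rw [h2] at h
  rw [intervalIntegral.integral_const_mul] at h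
  have h3 : ∫ θ in (0:ℝ)..(2 * Real.pi), EE B c r (-j) θ = JJ B c r (-j) := by
    rw [JJ]
    have := (EE_periodic B c r (-j)).intervalIntegral_add_eq 0 (-Real.pi)
    rw [zero_add] at this
    rw [this]; congr 1; ring
  rw [h3] at h
  have hrj : (r : ℂ) ^ j ≠ 0 := pow_ne_zero _ (by exact_mod_cast hr.ne')
  have hpi : ((2 * Real.pi : ℝ) : ℂ) ≠ 0 := by exact_mod_cast Real.two_pi_pos.ne'
  split_ifs with hj
  · subst hj
    have g0 : g 0 = Complex.exp (-KK B c r) := by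
      simp only [hg, pow_zero, mul_one, KK]
      congr 1
      push_cast
      rw [← Finset.sum_neg_distrib]
      apply Finset.sum_congr rfl
      intro a ha
      rw [zero_pow (hB a ha).ne']
      ring
    rw [g0, pow_zero, one_mul, Complex.real_smul, Complex.ofReal_inv, inv_mul_eq_iff_eq_mul₀ hpi] at h
    rw [h]; push_cast; rfl
  · have g0 : g 0 = 0 := by simp [hg, hj]
    rw [g0] at h
    simpa [hrj, Real.pi_ne_zero, hr.ne'] using h

lemma JJ_eq (B : Finset ℕ) (hB : ∀ a ∈ B, 0 < a) (c r : ℝ) (hc : 0 < c) (hr : 0 < r)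
    (b : ℕ → ℝ) (b0 : b 0 = 1) (hb : ∀ m : ℕ, c * m * b m = ∑ a ∈ B with a ≤ m, b (m - a)) (m : ℕ) :
    JJ B c r m = ((2 * Real.pi * Real.exp (-KK B c r) * r ^ m * b m : ℝ) : ℂ) := by
  induction m using Nat.strong_induction_on with
  | _ m ih =>
    rcases Nat.eq_zero_or_pos m with rfl | hm
    · have := JJ_neg B hB c r hr 0
      simpa [b0] using this
    · have h := JJ_rec B hB c r hc m
      have h2 : ∀ a ∈ B, ((r ^ a / c : ℝ) : ℂ) * JJ B c r (m - a) = 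
        if a ≤ m then ((r ^ a / c * (2 * Real.pi * Real.exp (-KK B c r) * r ^ (m - a) * b (m - a)) : ℝ) : ℂ) else 0 := by
        intro a ha
        split_ifs with hle
        · have := ih (m - a) (by have := hB a ha; omega)
          rw [Nat.cast_sub hle] at this
          rw [this]; push_cast; rfl
        · have := JJ_neg B hB c r hr (a - m)
          rw [if_neg (by omega), Nat.cast_sub (by omega), neg_sub] at this
          rw [this, mul_zero]
      rw [Finset.sum_congr rfl h2, ← Finset.sum_filter] at h
      have h3 : ∑ a ∈ B with a ≤ m, (r ^ a / c * (2 * Real.pi * Real.exp (-KK B c r) * r ^ (m - a) * b (m - a)))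
        = m * (2 * Real.pi * Real.exp (-KK B c r) * r ^ m * b m) := by
        have e : ∀ a ∈ B.filter (fun a => a ≤ m), (r ^ a / c * (2 * Real.pi * Real.exp (-KK B c r) * r ^ (m - a) * b (m - a)))
          = (2 * Real.pi * Real.exp (-KK B c r) * r ^ m / c) * b (m - a) := by
          intro a ha
          rw [← pow_mul_pow_sub r (Finset.mem_filter.1 ha).2]
          ring
        rw [Finset.sum_congr rfl e, ← Finset.mul_sum, ← hb]
        field_simp
      rw [← Complex.ofReal_sum, h3] at h
      have hm' : (m : ℂ) ≠ 0 := by exact_mod_cast hm.ne'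
      apply mul_left_cancel₀ hm'
      rw [Int.cast_natCast] at h
      rw [h]; push_cast; rfl
lemma EE_norm (B : Finset ℕ) (c r : ℝ) (n : ℤ) (θ : ℝ) :
    ‖EE B c r n θ‖ = Real.exp (-∑ a ∈ B, r ^ a / (c * a) * (1 - Real.cos (a * θ))) := by
  rw [EE, Complex.norm_exp]
  congr 1
  rw [Complex.sub_re, Complex.re_sum, ← Finset.sum_neg_distrib]
  have : ((n : ℂ) * θ * Complex.I).re = 0 := by
    have : (n : ℂ) * θ * Complex.I = ((n * θ : ℝ) : ℂ) * Complex.I := by push_cast; ring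
    rw [this, Complex.re_ofReal_mul]; simp
  rw [this, sub_zero]
  apply Finset.sum_congr rfl
  intro a _
  rw [Complex.re_ofReal_mul]
  have : (a : ℂ) * θ * Complex.I = ((a * θ : ℝ) : ℂ) * Complex.I := by push_cast; ring
  rw [this, Complex.sub_re, Complex.exp_ofReal_mul_I_re, Complex.one_re]
  ring

lemma exists_kappa (B : Finset ℕ) (hB : ∀ a ∈ B, 0 < a) (hg : B.gcd id = 1) (c : ℝ) (hc : 0 < c)
    (ε : ℝ) (hε : 0 < ε) : ∃ κ > 0, ∀ r : ℝ, 1 ≤ r → ∀ n θ, ε ≤ |θ| → |θ| ≤ Real.pi →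
      ‖EE B c r n θ‖ ≤ Real.exp (-(κ * r)) := by
  set g : ℝ → ℝ := fun θ => ∑ a ∈ B, 1 / (c * a) * (1 - Real.cos (a * θ)) with hgdef
  have hcont : Continuous g := by rw [hgdef]; fun_prop
  have hnn : ∀ a ∈ B, ∀ θ : ℝ, 0 ≤ 1 / (c * a) * (1 - Real.cos (a * θ)) := by
    intro a ha θ
    have := Real.cos_le_one (a * θ)
    have : 0 ≤ 1 - Real.cos (a * θ) := by linarith
    positivity
  have hpos : ∀ θ ∈ Set.Icc ε Real.pi, 0 < g θ := by
    intro θ hθ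
    by_contra hcon
    have h0 : g θ = 0 := le_antisymm (not_lt.1 hcon) (Finset.sum_nonneg fun a ha => hnn a ha θ)
    rw [hgdef] at h0
    have h1 := (Finset.sum_eq_zero_iff_of_nonneg fun a ha => hnn a ha θ).1 h0
    have h2 : ∀ a ∈ B, addOrderOf (θ : Real.Angle) ∣ a := by
      intro a ha
      apply addOrderOf_dvd_of_nsmul_eq_zero
      have := h1 a ha
      have ha' : (0:ℝ) < a := by exact_mod_cast hB a ha
      have hcos : Real.cos (a * θ) = 1 := by
        rcases mul_eq_zero.1 this with h | h
        · exfalso; have : 0 < 1 / (c * a) := by positivity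
          linarith
        · linarith
      obtain ⟨k, hk⟩ := (Real.cos_eq_one_iff _).1 hcos
      rw [← Real.Angle.coe_nsmul, nsmul_eq_mul, ← hk]
      have := Real.Angle.angle_eq_iff_two_pi_dvd_sub (ψ := (k * (2 * Real.pi))) (θ := 0)
      rw [← Real.Angle.coe_zero, eq_comm, this]
      exact ⟨-k, by push_cast; ring⟩
    have h3 : addOrderOf (θ : Real.Angle) ∣ 1 := by
      rw [← hg]
      exact Finset.dvd_gcd h2
    have h4 : (θ : Real.Angle) = 0 := by
      rw [← AddMonoid.addOrderOf_eq_one_iff]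
      exact Nat.dvd_one.1 h3
    have h5 : Real.cos θ = 1 := by
      rw [← Real.Angle.cos_coe, h4, Real.Angle.cos_zero]
    have h6 := (Real.cos_eq_one_iff_of_lt_of_lt (x := θ) (by linarith [hθ.1, Real.pi_pos])
      (by linarith [hθ.2, Real.pi_pos])).1 h5
    linarith [hθ.1]
  have hκ : ∃ κ > 0, ∀ θ ∈ Set.Icc ε Real.pi, κ ≤ g θ := by
    rcases (Set.Icc ε Real.pi).eq_empty_or_nonempty with he | hne
    · exact ⟨1, one_pos, by simp [he]⟩
    · obtain ⟨x, hx, hmin⟩ := isCompact_Icc.exists_isMinOn hne hcont.continuousOn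
      exact ⟨g x, hpos x hx, fun θ hθ => hmin hθ⟩
  obtain ⟨κ, hκ0, hκ⟩ := hκ
  refine ⟨κ, hκ0, fun r hr n θ h1 h2 => ?_⟩
  rw [EE_norm]
  apply Real.exp_le_exp.2
  apply neg_le_neg
  have h3 := hκ |θ| ⟨h1, h2⟩
  have h4 : g |θ| = g θ := by
    simp only [hgdef]
    apply Finset.sum_congr rfl
    intro a _
    have : (a : ℝ) * |θ| = |a * θ| := by rw [abs_mul, Nat.abs_cast]
    rw [this, Real.cos_abs]
  rw [h4] at h3
  calc κ * r ≤ g θ * r := by gcongr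
    _ = ∑ a ∈ B, r * (1 / (c * a) * (1 - Real.cos (a * θ))) := by
      rw [hgdef, Finset.sum_mul]; exact Finset.sum_congr rfl fun _ _ => mul_comm _ _
    _ ≤ ∑ a ∈ B, r ^ a / (c * a) * (1 - Real.cos (a * θ)) := by
      apply Finset.sum_le_sum
      intro a ha
      have e : r ^ a / (c * a) * (1 - Real.cos (a * θ)) = r ^ a * (1 / (c * a) * (1 - Real.cos (a * θ))) := by ring
      rw [e]
      apply mul_le_mul_of_nonneg_right _ (hnn a ha θ)
      exact le_self_pow₀ hr (hB a ha).ne'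

lemma EE_gauss (B : Finset ℕ) (D : ℕ) (hD : D ∈ B) (hD0 : 0 < D) (c r : ℝ) (hc : 0 < c)
    (hr : 0 < r) (n : ℤ) (θ : ℝ) (hθ : |D * θ| ≤ Real.pi) :
    ‖EE B c r n θ‖ ≤ Real.exp (-(r ^ D / c * (2 * D / Real.pi ^ 2) * θ ^ 2)) := by
  rw [EE_norm]
  apply Real.exp_le_exp.2
  apply neg_le_neg
  have h1 := Real.cos_le_one_sub_mul_cos_sq hθ
  have hD' : (0:ℝ) < D := by exact_mod_cast hD0
  calc r ^ D / c * (2 * D / Real.pi ^ 2) * θ ^ 2 = r ^ D / (c * D) * (2 / Real.pi ^ 2 * (D * θ) ^ 2) := by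
        field_simp
    _ ≤ r ^ D / (c * D) * (1 - Real.cos (D * θ)) := by
        gcongr; linarith
    _ ≤ _ := by
      apply Finset.single_le_sum (f := fun a : ℕ => r ^ a / (c * a) * (1 - Real.cos (a * θ))) _ hD
      intro a _
      have := Real.cos_le_one (a * θ)
      have : 0 ≤ 1 - Real.cos (a * θ) := by linarith
      positivity

lemma exp_second (x : ℝ) : Tendsto (fun m : ℕ => (m : ℂ) *
    (Complex.exp (x * ((1 / Real.sqrt m : ℝ) : ℂ) * Complex.I) - 1 - x * ((1 / Real.sqrt m : ℝ) : ℂ) * Complex.I)) atTop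
    (nhds (-(x ^ 2 / 2))) := by
  rw [tendsto_iff_norm_sub_tendsto_zero]
  have hs : Tendsto (fun m : ℕ => 1 / Real.sqrt m) atTop (nhds 0) := by
    simp_rw [one_div]
    exact tendsto_inv_atTop_zero.comp (Real.tendsto_sqrt_atTop.comp tendsto_natCast_atTop_atTop)
  have hlim : Tendsto (fun m : ℕ => |x| ^ 3 * (1 / Real.sqrt m)) atTop (nhds 0) := by
    simpa using hs.const_mul (|x| ^ 3)
  have hx : ∀ᶠ m : ℕ in atTop, |x| * (1 / Real.sqrt m) < 1 := by
    have : Tendsto (fun m : ℕ => |x| * (1 / Real.sqrt m)) atTop (nhds 0) := by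
      simpa using hs.const_mul |x|
    exact this.eventually_lt_const one_pos
  refine squeeze_zero' (Eventually.of_forall fun _ => norm_nonneg _) ?_ hlim
  filter_upwards [hx, eventually_gt_atTop 0] with m hm hm0
  set u := 1 / Real.sqrt m with hu
  have hm0' : (0:ℝ) < m := by exact_mod_cast hm0
  have hu0 : 0 < u := by positivity
  have hmu : (m : ℝ) * u ^ 2 = 1 := by
    rw [hu, div_pow, Real.sq_sqrt hm0'.le]; field_simp
  have hmuC : (m : ℂ) * (u : ℂ) ^ 2 = 1 := by exact_mod_cast hmu
  set z : ℂ := x * (u : ℂ) * Complex.I with hz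
  have hzn : ‖z‖ = |x| * u := by
    rw [hz, norm_mul, norm_mul, Complex.norm_real, Complex.norm_real, Complex.norm_I, mul_one,
      Real.norm_eq_abs, Real.norm_eq_abs, abs_of_pos hu0]
  have hb := Complex.exp_bound (x := z) (by rw [hzn]; exact hm.le) (n := 3) (by norm_num)
  have e : (m : ℂ) * (Complex.exp z - 1 - z) - -((x : ℂ) ^ 2 / 2)
      = m * (Complex.exp z - ∑ i ∈ Finset.range 3, z ^ i / (i.factorial : ℂ)) := by
    simp only [Finset.sum_range_succ, Finset.sum_range_zero]
    norm_num [Nat.factorial]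
    have hz2 : z ^ 2 = - (x ^ 2 * (u : ℂ) ^ 2) := by
      rw [hz, mul_pow, Complex.I_sq]; ring
    rw [hz2]
    have : (x : ℂ) ^ 2 / 2 = (x : ℂ) ^ 2 / 2 * (m * (u : ℂ) ^ 2) := by rw [hmuC, mul_one]
    rw [this]; ring
  rw [e, norm_mul, Complex.norm_natCast]
  calc (m : ℝ) * _ ≤ m * (‖z‖ ^ 3 * ((Nat.succ 3 : ℝ) * ((Nat.factorial 3 : ℝ) * (3 : ℕ))⁻¹)) := by
        gcongr
    _ ≤ m * (‖z‖ ^ 3 * 1) := by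
        gcongr
        norm_num [Nat.factorial]
    _ = |x| ^ 3 * u * (m * u ^ 2) := by rw [hzn]; ring
    _ = _ := by rw [hmu, mul_one]

lemma exists_saddle (B : Finset ℕ) (hB : ∀ a ∈ B, 0 < a) (hne : B.Nonempty) (c : ℝ) (hc : 0 < c) :
    ∃ r : ℕ → ℝ, (∀ m, 0 ≤ r m) ∧ (∀ m : ℕ, ∑ a ∈ B, r m ^ a = c * m) := by
  have : ∀ m : ℕ, ∃ r : ℝ, 0 ≤ r ∧ ∑ a ∈ B, r ^ a = c * m := by
    intro m
    have hcm : 0 ≤ c * m := by positivity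
    have hcont : ContinuousOn (fun r : ℝ => ∑ a ∈ B, r ^ a) (Set.Icc 0 (c * m + 1)) := by fun_prop
    have h := intermediate_value_Icc (by linarith) hcont
    have hm : c * m ∈ Set.Icc ((fun r : ℝ => ∑ a ∈ B, r ^ a) 0) ((fun r : ℝ => ∑ a ∈ B, r ^ a) (c * m + 1)) := by
      constructor
      · have : ∑ a ∈ B, (0:ℝ) ^ a = 0 := Finset.sum_eq_zero fun a ha => zero_pow (hB a ha).ne'
        simpa [this] using hcm
      · obtain ⟨a, ha⟩ := hne
        calc c * m ≤ c * m + 1 := by linarith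
          _ ≤ (c * m + 1) ^ a := le_self_pow₀ (by linarith) (hB a ha).ne'
          _ ≤ _ := Finset.single_le_sum (f := fun a : ℕ => (c * m + 1) ^ a) (fun _ _ => by positivity) ha
    obtain ⟨r, hr, hr2⟩ := h hm
    exact ⟨r, hr.1, hr2⟩
  choose r h1 h2 using this
  exact ⟨r, h1, h2⟩

lemma saddle_atTop (B : Finset ℕ) (c : ℝ) (hc : 0 < c) (r : ℕ → ℝ) (hr : ∀ m, 0 ≤ r m)
    (hs : ∀ m : ℕ, ∑ a ∈ B, r m ^ a = c * m) : Tendsto r atTop atTop := by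
  rw [tendsto_atTop]
  intro M
  have : Tendsto (fun m : ℕ => c * (m : ℝ)) atTop atTop :=
    tendsto_natCast_atTop_atTop.const_mul_atTop hc
  filter_upwards [this.eventually_gt_atTop (∑ a ∈ B, M ^ a)] with m hm
  by_contra! hcon
  rw [← hs] at hm
  have : ∑ a ∈ B, r m ^ a ≤ ∑ a ∈ B, M ^ a :=
    Finset.sum_le_sum fun a _ => pow_le_pow_left₀ (hr m) hcon.le a
  linarith

lemma saddle_ratio (B : Finset ℕ) (D : ℕ) (hD : D ∈ B) (hmax : ∀ a ∈ B, a ≤ D)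
    (c : ℝ) (hc : 0 < c) (r : ℕ → ℝ) (hr : ∀ m, 0 ≤ r m)
    (hs : ∀ m : ℕ, ∑ a ∈ B, r m ^ a = c * m) (a : ℕ) (ha : a ∈ B) :
    Tendsto (fun m : ℕ => r m ^ a / (c * m)) atTop (nhds (if a = D then 1 else 0)) := by
  have hT := saddle_atTop B c hc r hr hs
  have h1 : ∀ a ∈ B, Tendsto (fun m : ℕ => r m ^ a / r m ^ D) atTop (nhds (if a = D then 1 else 0)) := by
    intro a ha
    split_ifs with h
    · subst h
      apply tendsto_const_nhds.congr'
      filter_upwards [hT.eventually_gt_atTop 0] with m hm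
      rw [div_self (by positivity)]
    · have := (tendsto_pow_div_pow_atTop_zero (𝕜 := ℝ) (lt_of_le_of_ne (hmax a ha) h)).comp hT
      exact this
  have h2 : Tendsto (fun m : ℕ => c * m / r m ^ D) atTop (nhds 1) := by
    have := tendsto_finsetSum B h1
    simp only [Finset.sum_ite_eq', hD, if_true] at this
    refine this.congr fun m => ?_
    rw [← hs, Finset.sum_div]
  have h3 := (h1 a ha).div h2 one_ne_zero
  rw [div_one] at h3
  apply h3.congr'
  filter_upwards [hT.eventually_gt_atTop 0, eventually_gt_atTop 0] with m hm hm0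
  have : (0:ℝ) < m := by exact_mod_cast hm0
  simp only [Pi.div_apply]
  field_simp

lemma saddle_point (B : Finset ℕ) (hB : ∀ a ∈ B, 0 < a) (D : ℕ) (hD : D ∈ B) 
    (hmax : ∀ a ∈ B, a ≤ D)
    (c : ℝ) (hc : 0 < c) (r : ℕ → ℝ) (hr : ∀ m, 0 ≤ r m)
    (hs : ∀ m : ℕ, ∑ a ∈ B, r m ^ a = c * m) (j : ℕ) (t : ℝ) :
    Tendsto (fun m : ℕ => EE B c (r m) (m - j) (t / Real.sqrt m)) atTop
      (nhds (Complex.exp (-(D / 2) * t ^ 2))) := by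
  unfold EE
  apply (Complex.continuous_exp.tendsto _).comp
  have h1 : Tendsto (fun m : ℕ => ∑ a ∈ B, ((r m ^ a / (c * m) : ℝ) : ℂ) * ((1 / a : ℂ) *
      ((m : ℂ) * (Complex.exp (((a * t : ℝ) : ℂ) * ((1 / Real.sqrt m : ℝ) : ℂ) * Complex.I) - 1
        - ((a * t : ℝ) : ℂ) * ((1 / Real.sqrt m : ℝ) : ℂ) * Complex.I)))) atTop
      (nhds (∑ a ∈ B, (((if a = D then 1 else 0 : ℝ)) : ℂ) * ((1 / a : ℂ) * (-(((a * t : ℝ) : ℂ) ^ 2 / 2))))) := by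
    apply tendsto_finsetSum
    intro a ha
    apply Tendsto.mul
    · exact (Complex.continuous_ofReal.tendsto _).comp (saddle_ratio B D hD hmax c hc r hr hs a ha)
    · exact (exp_second (a * t)).const_mul _
  have h2 : Tendsto (fun m : ℕ => (j : ℂ) * t * Complex.I * ((1 / Real.sqrt m : ℝ) : ℂ)) atTop (nhds 0) := by
    have hs : Tendsto (fun m : ℕ => 1 / Real.sqrt m) atTop (nhds 0) := by
      simp_rw [one_div]
      exact tendsto_inv_atTop_zero.comp (Real.tendsto_sqrt_atTop.comp tendsto_natCast_atTop_atTop)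
    have := ((Complex.continuous_ofReal.tendsto _).comp hs).const_mul ((j : ℂ) * t * Complex.I)
    simpa using this
  have h3 := h1.add h2
  have e : ∑ a ∈ B, (((if a = D then 1 else 0 : ℝ)) : ℂ) * ((1 / a : ℂ) * (-(((a * t : ℝ) : ℂ) ^ 2 / 2))) + 0
      = -((D : ℂ) / 2) * (t : ℂ) ^ 2 := by
    rw [Finset.sum_eq_single_of_mem D hD]
    · have : (D : ℂ) ≠ 0 := by exact_mod_cast (hB D hD).ne'
      push_cast
      simp only [if_true, Complex.ofReal_one, add_zero]
      field_simp
    · intro a _ h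
      rw [if_neg h, Complex.ofReal_zero, zero_mul]
  rw [e] at h3
  apply h3.congr'
  filter_upwards [eventually_gt_atTop 0] with m hm
  have hm' : (m : ℂ) ≠ 0 := by exact_mod_cast hm.ne'
  have hc' : (c : ℂ) ≠ 0 := by exact_mod_cast hc.ne'
  have hsum : (m : ℂ) = ∑ a ∈ B, ((r m ^ a / c : ℝ) : ℂ) := by
    rw [← Complex.ofReal_sum, ← Finset.sum_div, hs]
    push_cast
    field_simp
  have e1 : (((m : ℤ) - (j : ℤ) : ℤ) : ℂ) * ((t / Real.sqrt m : ℝ) : ℂ) * Complex.I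
     = ∑ a ∈ B, ((r m ^ a / c : ℝ) : ℂ) * ((t / Real.sqrt m : ℝ) : ℂ) * Complex.I
       - (j : ℂ) * t * Complex.I * ((1 / Real.sqrt m : ℝ) : ℂ) := by
    rw [← Finset.sum_mul, ← Finset.sum_mul, ← hsum]
    push_cast
    ring
  rw [e1, ← sub_add, ← Finset.sum_sub_distrib]
  congr 1
  apply Finset.sum_congr rfl
  intro a ha
  have ha' : (a : ℂ) ≠ 0 := by exact_mod_cast (hB a ha).ne'
  have e2 : (a : ℂ) * ((t / Real.sqrt m : ℝ) : ℂ) * Complex.I = ((a * t : ℝ) : ℂ) * ((1 / Real.sqrt m : ℝ) : ℂ) * Complex.I := by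
    push_cast; ring
  rw [e2]
  have e3 : ((r m ^ a / c : ℝ) : ℂ) * ((t / Real.sqrt m : ℝ) : ℂ) * Complex.I
    = ((r m ^ a / (c * a) : ℝ) : ℂ) * (((a * t : ℝ) : ℂ) * ((1 / Real.sqrt m : ℝ) : ℂ) * Complex.I) := by
    push_cast
    field_simp
  rw [e3]
  generalize Complex.exp (((a * t : ℝ) : ℂ) * ((1 / Real.sqrt m : ℝ) : ℂ) * Complex.I) = X
  generalize ((a * t : ℝ) : ℂ) * ((1 / Real.sqrt m : ℝ) : ℂ) * Complex.I = Y
  push_cast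
  field_simp

lemma JJ_asymp (B : Finset ℕ) (hB : ∀ a ∈ B, 0 < a) (hg : B.gcd id = 1) (D : ℕ) (hD : D ∈ B) 
    (hmax : ∀ a ∈ B, a ≤ D)
    (c : ℝ) (hc : 0 < c) (r : ℕ → ℝ) (hr : ∀ m, 0 ≤ r m)
    (hs : ∀ m : ℕ, ∑ a ∈ B, r m ^ a = c * m) (j : ℕ) :
    Tendsto (fun m : ℕ => ((Real.sqrt m : ℝ) : ℂ) * JJ B c (r m) (m - j)) atTop
      (nhds (∫ t : ℝ, Complex.exp (-(D / 2) * t ^ 2))) := by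
  have hT := saddle_atTop B c hc r hr hs
  have hD0 := hB D hD
  have hD' : (0:ℝ) < D := by exact_mod_cast hD0
  have hpi := Real.pi_pos
  set ε := Real.pi / D with hε
  have hε0 : 0 < ε := by positivity
  have hεpi : ε ≤ Real.pi := by
    rw [hε]; apply div_le_self hpi.le; exact_mod_cast hD0
  obtain ⟨κ, hκ0, hκ⟩ := exists_kappa B hB hg c hc ε hε0
  have hcard : (0:ℝ) < B.card := by exact_mod_cast Finset.card_pos.2 ⟨D, hD⟩
  have hcm : ∀ m, 1 ≤ r m → c * m ≤ B.card * r m ^ D := by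
    intro m hm
    rw [← hs, ← nsmul_eq_mul]
    exact Finset.sum_le_card_nsmul _ _ _ fun a ha => pow_le_pow_right₀ hm (hmax a ha)
  -- the middle piece
  have hmid : Tendsto (fun m : ℕ => ((Real.sqrt m : ℝ) : ℂ) * ∫ θ in (-ε)..ε, EE B c (r m) (m - j) θ) atTop
      (nhds (∫ t : ℝ, Complex.exp (-(D / 2) * t ^ 2))) := by
    have h1 : Tendsto (fun m : ℕ => ∫ t : ℝ, (Set.Ioc (-ε * Real.sqrt m) (ε * Real.sqrt m)).indicator
        (fun t => EE B c (r m) (m - j) (t / Real.sqrt m)) t) atTop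
        (nhds (∫ t : ℝ, Complex.exp (-(D / 2) * t ^ 2))) := by
      apply MeasureTheory.tendsto_integral_filter_of_dominated_convergence
        (fun t : ℝ => Real.exp (-(2 * D / (Real.pi ^ 2 * B.card)) * t ^ 2))
      · refine Eventually.of_forall fun m => ?_
        apply MeasureTheory.AEStronglyMeasurable.indicator _ measurableSet_Ioc
        exact ((EE_cont B c (r m) (m - j)).comp (continuous_id.div_const _)).aestronglyMeasurable
      · filter_upwards [hT.eventually_ge_atTop 1, eventually_gt_atTop 0] with m hm hm0
        refine Eventually.of_forall fun t => ?_
        have hm0' : (0:ℝ) < m := by exact_mod_cast hm0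
        have hsq : 0 < Real.sqrt m := Real.sqrt_pos.2 hm0'
        by_cases ht : t ∈ Set.Ioc (-ε * Real.sqrt m) (ε * Real.sqrt m)
        · rw [Set.indicator_of_mem ht]
          have habs : |t| ≤ ε * Real.sqrt m := abs_le.2 ⟨by linarith [ht.1], ht.2⟩
          have hb : |(D:ℝ) * (t / Real.sqrt m)| ≤ Real.pi := by
            rw [abs_mul, abs_div, Nat.abs_cast, abs_of_pos hsq]
            have : |t| / Real.sqrt m ≤ ε := by rwa [div_le_iff₀ hsq]
            calc (D:ℝ) * (|t| / Real.sqrt m) ≤ D * ε := by gcongr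
              _ = Real.pi := by rw [hε]; field_simp
          refine (EE_gauss B D hD hD0 c (r m) hc (by linarith) _ _ hb).trans ?_
          apply Real.exp_le_exp.2
          rw [neg_mul]
          apply neg_le_neg
          rw [div_pow, Real.sq_sqrt hm0'.le]
          have h2 : (m:ℝ) / B.card ≤ r m ^ D / c := by
            rw [div_le_div_iff₀ hcard hc]
            have := hcm m hm
            linarith
          calc 2 * D / (Real.pi ^ 2 * B.card) * t ^ 2 = (m:ℝ) / B.card * (2 * D / Real.pi ^ 2) * (t ^ 2 / m) := by
                field_simp
            _ ≤ _ := by gcongr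
        · rw [Set.indicator_of_notMem ht, norm_zero]; positivity
      · apply integrable_exp_neg_mul_sq
        positivity
      · refine Eventually.of_forall fun t => ?_
        apply (saddle_point B hB D hD hmax c hc r hr hs j t).congr'
        have h3 : Tendsto (fun m : ℕ => ε * Real.sqrt m) atTop atTop :=
          (Real.tendsto_sqrt_atTop.comp tendsto_natCast_atTop_atTop).const_mul_atTop hε0
        filter_upwards [h3.eventually_gt_atTop |t|] with m hm
        rw [Set.indicator_of_mem]
        have := abs_lt.1 hm
        exact ⟨by linarith [this.1], this.2.le⟩
    apply h1.congr'
    filter_upwards [eventually_gt_atTop 0] with m hm0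
    have hm0' : (0:ℝ) < m := by exact_mod_cast hm0
    have hsq : 0 < Real.sqrt m := Real.sqrt_pos.2 hm0'
    rw [MeasureTheory.integral_indicator measurableSet_Ioc, ← intervalIntegral.integral_of_le (by nlinarith),
      intervalIntegral.integral_comp_div (fun t => EE B c (r m) (m - j) t) hsq.ne']
    rw [mul_div_cancel_right₀ _ hsq.ne', mul_div_cancel_right₀ _ hsq.ne', Complex.real_smul]
  -- the tails
  have hexp : Tendsto (fun m : ℕ => Real.sqrt m * (Real.exp (-(κ * r m)) * (Real.pi - ε))) atTop (nhds 0) := by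
    have h1 : Tendsto (fun x : ℝ => x ^ D * Real.exp (-(κ * x))) atTop (nhds 0) := by
      have := tendsto_rpow_mul_exp_neg_mul_atTop_nhds_zero (D:ℝ) κ hκ0
      simpa [neg_mul] using this
    have h2 := ((h1.comp hT).const_mul (B.card / c)).mul_const (Real.pi - ε)
    simp only [mul_zero, zero_mul] at h2
    refine squeeze_zero' (Eventually.of_forall fun m => ?_) ?_ h2
    · have : 0 ≤ Real.pi - ε := by linarith
      positivity
    · filter_upwards [hT.eventually_ge_atTop 1, eventually_gt_atTop 0] with m hm hm0
      have hm1 : (1:ℝ) ≤ m := by exact_mod_cast hm0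
      have h3 : Real.sqrt m ≤ m := by
        rw [Real.sqrt_le_left (by linarith)]; nlinarith
      have h4 : (m:ℝ) ≤ B.card / c * r m ^ D := by
        rw [div_mul_eq_mul_div, le_div_iff₀ hc]
        have := hcm m hm
        linarith
      have : 0 ≤ Real.pi - ε := by linarith
      simp only [Function.comp_apply]
      calc _ ≤ B.card / c * r m ^ D * (Real.exp (-(κ * r m)) * (Real.pi - ε)) := by
            gcongr; linarith
        _ = _ := by ring
  have htail : ∀ (x y : ℝ), x ≤ y → y - x = Real.pi - ε → (∀ θ ∈ Set.Ioc x y, ε ≤ |θ| ∧ |θ| ≤ Real.pi) →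
      Tendsto (fun m : ℕ => ((Real.sqrt m : ℝ) : ℂ) * ∫ θ in x..y, EE B c (r m) (m - j) θ) atTop (nhds 0) := by
    intro x y hxy hd hin
    rw [tendsto_zero_iff_norm_tendsto_zero]
    refine squeeze_zero' (Eventually.of_forall fun m => norm_nonneg _) ?_ hexp
    filter_upwards [hT.eventually_ge_atTop 1] with m hm
    rw [norm_mul, Complex.norm_real, Real.norm_eq_abs, abs_of_nonneg (Real.sqrt_nonneg _)]
    gcongr
    have := intervalIntegral.norm_integral_le_of_norm_le_const (a := x) (b := y)
      (f := EE B c (r m) (m - j)) (C := Real.exp (-(κ * r m))) (by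
        intro θ hθ
        rw [Set.uIoc_of_le hxy] at hθ
        exact hκ (r m) hm _ θ (hin θ hθ).1 (hin θ hθ).2)
    rwa [hd, abs_of_nonneg (by linarith)] at this
  have hL := htail (-Real.pi) (-ε) (by linarith) (by ring) (by
    intro θ hθ
    rw [abs_of_nonpos (by linarith [hθ.2])]
    constructor <;> linarith [hθ.1, hθ.2])
  have hR := htail ε Real.pi hεpi rfl (by
    intro θ hθ
    rw [abs_of_nonneg (by linarith [hθ.1])]
    constructor <;> linarith [hθ.1, hθ.2])
  have hall := (hL.add hmid).add hR
  rw [zero_add, add_zero] at hall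
  refine hall.congr fun m => ?_
  have hi : ∀ x y, IntervalIntegrable (EE B c (r m) (m - j)) MeasureTheory.volume x y :=
    fun x y => (EE_cont B c (r m) (m - j)).intervalIntegrable _ _
  rw [JJ, ← mul_add, intervalIntegral.integral_add_adjacent_intervals (hi _ _) (hi _ _), ← mul_add,
    intervalIntegral.integral_add_adjacent_intervals (hi _ _) (hi _ _)]

lemma gauss_ne (D : ℕ) (hD : 0 < D) : (∫ t : ℝ, Complex.exp (-(D / 2) * t ^ 2)) ≠ 0 := by
  have hD' : (0:ℝ) < D := by exact_mod_cast hD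
  have e : ∀ t : ℝ, Complex.exp (-(D / 2) * t ^ 2) = ((Real.exp (-(D / 2) * t ^ 2) : ℝ) : ℂ) := by
    intro t; push_cast; rfl
  simp_rw [e]
  rw [integral_complex_ofReal, integral_gaussian]
  norm_cast
  positivity

lemma ratio_asymp (B : Finset ℕ) (hB : ∀ a ∈ B, 0 < a) (hg : B.gcd id = 1) (D : ℕ) (hD : D ∈ B) 
    (hmax : ∀ a ∈ B, a ≤ D) (c : ℝ) (hc : 0 < c) 
    (b : ℕ → ℝ) (b0 : b 0 = 1) (hb : ∀ m : ℕ, c * m * b m = ∑ a ∈ B with a ≤ m, b (m - a)) (j : ℕ) :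
    Tendsto (fun m : ℕ => b (m - j) / b m / (c * m) ^ ((j : ℝ) / D)) atTop (nhds 1) := by
  obtain ⟨r, hr, hs⟩ := exists_saddle B hB ⟨D, hD⟩ c hc
  have hT := saddle_atTop B c hc r hr hs
  have hD' : (0:ℝ) < D := by exact_mod_cast hB D hD
  have hL := gauss_ne D (hB D hD)
  have h0 := JJ_asymp B hB hg D hD hmax c hc r hr hs 0
  have hj := JJ_asymp B hB hg D hD hmax c hc r hr hs j
  have h1 := hj.div h0 hL
  rw [div_self hL] at h1
  have h2 : Tendsto (fun m : ℕ => ((b (m - j) / b m / r m ^ j : ℝ) : ℂ)) atTop (nhds ((1:ℝ):ℂ)) := by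
    rw [Complex.ofReal_one]
    apply h1.congr'
    filter_upwards [hT.eventually_gt_atTop 0, eventually_gt_atTop 0, eventually_ge_atTop j] with m hm hm0 hmj
    have hm0' : (0:ℝ) < m := by exact_mod_cast hm0
    have hsq : 0 < Real.sqrt m := Real.sqrt_pos.2 hm0'
    have e1 : JJ B c (r m) (m - j) = ((2 * Real.pi * Real.exp (-KK B c (r m)) * r m ^ (m - j) * b (m - j) : ℝ) : ℂ) := by
      rw [← Nat.cast_sub hmj]
      exact JJ_eq B hB c (r m) hc hm b b0 hb (m - j)
    have e2 : JJ B c (r m) (m - (0:ℕ)) = ((2 * Real.pi * Real.exp (-KK B c (r m)) * r m ^ m * b m : ℝ) : ℂ) := by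
      rw [Nat.cast_zero, sub_zero]
      exact JJ_eq B hB c (r m) hc hm b b0 hb m
    simp only [Pi.div_apply]
    rw [e1, e2, ← Complex.ofReal_mul, ← Complex.ofReal_mul, ← Complex.ofReal_div]
    congr 1
    rw [← pow_sub_mul_pow (r m) hmj]
    have := Real.exp_pos (-KK B c (r m))
    have := Real.pi_pos
    field_simp
  have h3 : Tendsto (fun m : ℕ => b (m - j) / b m / r m ^ j) atTop (nhds 1) := by
    have := (Complex.continuous_re.tendsto _).comp h2
    simpa only [Function.comp_def, Complex.ofReal_re] using this
  have h4 := saddle_ratio B D hD hmax c hc r hr hs D hD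
  rw [if_pos rfl] at h4
  have h5 := h4.rpow_const (p := (j : ℝ) / D) (Or.inl one_ne_zero)
  rw [Real.one_rpow] at h5
  have h6 := h3.mul h5
  rw [one_mul] at h6
  apply h6.congr'
  filter_upwards [hT.eventually_gt_atTop 0, eventually_gt_atTop 0] with m hm hm0
  have hm0' : (0:ℝ) < m := by exact_mod_cast hm0
  rw [Real.div_rpow (by positivity) (by positivity), ← Real.rpow_natCast_mul hm.le,
    mul_div_cancel₀ _ hD'.ne', Real.rpow_natCast]
  have : 0 < r m ^ j := by positivity
  field_simp

theorem stmt_11 (A : Finset ℕ) (hA : A.Nonempty) (hApos : ∀ a ∈ A, 0 < a)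
    (d p : ℕ) (hd : d = A.max' hA) (hp : p = A.gcd id)
    (k : ℕ) (hk : 0 < k) (hpk : p ∣ k) :
    Tendsto (fun n : ℕ =>
        (((permCount ↑A (n - k) : ℝ) / (n - k).factorial) /
          ((permCount ↑A n : ℝ) / n.factorial)) / (n : ℝ) ^ ((k : ℝ) / d))
      (atTop ⊓ Filter.principal {n | p ∣ n}) (nhds 1) := by
  simp_rw [permCount_div]
  have hdvd : ∀ a ∈ A, p ∣ a := fun a ha => hp ▸ Finset.gcd_dvd ha
  have hdA : d ∈ A := hd ▸ A.max'_mem hA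
  have hp0 : 0 < p := Nat.pos_of_dvd_of_pos (hdvd d hdA) (hApos d hdA)
  obtain ⟨j, rfl⟩ := hpk
  obtain ⟨D, rfl⟩ := hdvd d hdA
  have hmem : ∀ b ∈ A.image (· / p), p * b ∈ A := by
    intro b hb
    obtain ⟨a, ha, rfl⟩ := Finset.mem_image.1 hb
    simpa only [Nat.mul_div_cancel' (hdvd a ha)] using ha
  have hpR : (0:ℝ) < p := by exact_mod_cast hp0
  have main := ratio_asymp (A.image (· / p))
    (fun b hb => Nat.pos_of_mul_pos_left (hApos _ (hmem b hb)))
    (by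
      rw [Finset.gcd_image]
      have := Finset.gcd_div_id_eq_one hdA (hApos _ hdA).ne'
      rw [← hp] at this
      exact this)
    D (Finset.mem_image.2 ⟨p * D, hdA, Nat.mul_div_cancel_left _ hp0⟩)
    (by
      intro b hb
      have := A.le_max' _ (hmem b hb)
      rw [← hd] at this
      exact Nat.le_of_mul_le_mul_left this hp0)
    p hpR (fun m => Sw A (p * m)) (by simp [Sw_zero])
    (by
      intro m
      have h := Sw_rec A hApos (p * m)
      rw [Nat.cast_mul] at h
      rw [h, Finset.sum_filter, Finset.sum_filter, Finset.sum_image]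
      · apply Finset.sum_congr rfl
        intro a ha
        obtain ⟨b, rfl⟩ := hdvd a ha
        simp only [Nat.mul_div_cancel_left _ hp0, Nat.mul_le_mul_left_iff hp0, Nat.mul_sub]
      · intro x hx y hy hxy
        have hxy' : x / p = y / p := hxy
        rw [← Nat.mul_div_cancel' (hdvd x hx), hxy', Nat.mul_div_cancel' (hdvd y hy)])
    j
  have hdiv : Tendsto (fun n : ℕ => n / p) (atTop ⊓ Filter.principal {n | p ∣ n}) atTop :=
    (Nat.tendsto_div_const_atTop hp0.ne').mono_left inf_le_left
  apply (main.comp hdiv).congr'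
  have hev : ∀ᶠ n in (atTop ⊓ Filter.principal {n : ℕ | p ∣ n}), p ∣ n :=
    mem_inf_of_right (mem_principal_self _)
  filter_upwards [hev] with n hn
  obtain ⟨m, rfl⟩ := hn
  simp only [Function.comp_apply, Nat.mul_div_cancel_left _ hp0, Nat.mul_sub]
  push_cast
  rw [mul_div_mul_left _ _ hpR.ne']
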